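/- Let u₁, u₂, u₃, u₄ ∈ ℂ with Re uᵢ > 1 for i = 1,2,3,4. Then ∫₀¹ ∏_{i=1}^4 ζ₁(uᵢ,α) dα = 1/(u₁+u₂+u₃+u₄−1) + ∑_{i=1}^4 ∫₁^∞ α^{−(u_j+u_k+u_l)} ζ₁(u_i,α) dα (where {j,k,l} = {1,2,3,4}\{i}, giving 4 terms) + ∑_{pairs {i,j}} ∫₁^∞ α^{−(u_i+u_j)} ζ₁(u_k,α) ζ₁(u_l,α) dα (where {k,l} = {1,2,3,4}\{i,j}, giving 6 terms) + ∑_{i=1}^4 ∫₁^∞ α^{−u_i} ∏_{j ≠ i} ζ₁(u_j,α) dα (giving 4 terms). -/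

import Mathlib

open Complex MeasureTheory Real

/-- The modified Hurwitz zeta function `ζ₁(s, α) = ∑_{n=1}^∞ (n+α)^{-s}`,
as an absolutely convergent series (valid for `Re s > 1`, `α > 0`). -/
noncomputable def zeta1 (s : ℂ) (α : ℝ) : ℂ := ∑' n : ℕ, (((n : ℂ) + 1) + (α : ℂ)) ^ (-s)

theorem norm_zeta1_term (s : ℂ) (n : ℕ) {x : ℝ} (hx : 0 ≤ x) :
    ‖((n : ℂ) + 1 + (x : ℂ)) ^ (-s)‖ = ((n : ℝ) + 1 + x) ^ (-s.re) := by
  have h : (n : ℂ) + 1 + (x : ℂ) = ((n + 1 + x : ℝ) : ℂ) := by push_cast; ring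
  rw [h, norm_cpow_eq_rpow_re_of_pos (by positivity), neg_re]

theorem norm_zeta1_term_le {s : ℂ} (hs : 1 < s.re) (n : ℕ) {x : ℝ} (hx : 0 ≤ x) :
    ‖((n : ℂ) + 1 + (x : ℂ)) ^ (-s)‖ ≤ ((n : ℝ) + 1) ^ (-s.re) := by
  rw [norm_zeta1_term s n hx]
  exact Real.rpow_le_rpow_of_nonpos (by positivity) (by linarith) (by linarith)

theorem summable_nat_add_one_rpow_neg {r : ℝ} (hr : 1 < r) :
    Summable fun n : ℕ => ((n : ℝ) + 1) ^ (-r) := by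
  have h := (summable_nat_add_iff 1).2 (Real.summable_nat_rpow.2 (show -r < -1 by linarith))
  simpa using h

theorem summable_zeta1_term {s : ℂ} (hs : 1 < s.re) {x : ℝ} (hx : 0 ≤ x) :
    Summable fun n : ℕ => ((n : ℂ) + 1 + (x : ℂ)) ^ (-s) :=
  .of_norm_bounded (summable_nat_add_one_rpow_neg hs) fun n => norm_zeta1_term_le hs n hx

theorem zeta1_sub_one {s : ℂ} (hs : 1 < s.re) {x : ℝ} (hx : 1 ≤ x) :
    zeta1 s (x - 1) = (x : ℂ) ^ (-s) + zeta1 s x := by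
  rw [zeta1, (summable_zeta1_term hs (sub_nonneg.2 hx)).tsum_eq_zero_add, zeta1]
  congr 1
  · congr 1; push_cast; ring
  · refine tsum_congr fun n => ?_
    congr 1; push_cast; ring

theorem norm_zeta1_le {s : ℂ} (hs : 1 < s.re) {x : ℝ} (hx : 0 ≤ x) :
    ‖zeta1 s x‖ ≤ ∑' n : ℕ, ((n : ℝ) + 1) ^ (-s.re) :=
  tsum_of_norm_bounded (summable_nat_add_one_rpow_neg hs).hasSum
    fun n => norm_zeta1_term_le hs n hx

theorem continuousOn_zeta1 {s : ℂ} (hs : 1 < s.re) : ContinuousOn (zeta1 s) (Set.Ici 0) := by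
  refine continuousOn_tsum (fun n => ?_) (summable_nat_add_one_rpow_neg hs)
    fun n x hx => norm_zeta1_term_le hs n hx
  refine ContinuousOn.cpow_const (by fun_prop) fun x hx => ?_
  left
  have : (0 : ℝ) ≤ x := hx
  simp only [add_re, natCast_re, one_re, ofReal_re]
  positivity

theorem tendsto_zeta1_atTop {s : ℂ} (hs : 1 < s.re) :
    Filter.Tendsto (zeta1 s) Filter.atTop (nhds 0) := by
  have h := tendsto_tsum_of_dominated_convergence (𝓕 := Filter.atTop)
    (f := fun (x : ℝ) (n : ℕ) => ((n : ℂ) + 1 + (x : ℂ)) ^ (-s)) (g := fun _ => 0)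
    (summable_nat_add_one_rpow_neg hs) (fun n => ?_) ?_
  · rw [tsum_zero] at h
    exact h
  · rw [tendsto_zero_iff_norm_tendsto_zero]
    have h : Filter.Tendsto (fun x : ℝ => ((n : ℝ) + 1 + x) ^ (-s.re)) Filter.atTop (nhds 0) :=
      (tendsto_rpow_neg_atTop (by linarith)).comp
        (Filter.tendsto_atTop_add_const_left _ _ Filter.tendsto_id)
    refine h.congr' ?_
    filter_upwards [Filter.eventually_ge_atTop 0] with x hx
    exact (norm_zeta1_term s n hx).symm
  · filter_upwards [Filter.eventually_ge_atTop 0] with x hx n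
    exact norm_zeta1_term_le hs n hx

theorem MeasureTheory.IntegrableOn.mul_zeta1 {s : ℂ} (hs : 1 < s.re) {f : ℝ → ℂ}
    (hf : IntegrableOn f (Set.Ioi 1)) :
    IntegrableOn (fun x => f x * zeta1 s x) (Set.Ioi 1) := by
  have hsub : Set.Ioi (1 : ℝ) ⊆ Set.Ici 0 :=
    Set.Ioi_subset_Ici zero_le_one
  refine Integrable.mul_bdd (c := ∑' n : ℕ, ((n : ℝ) + 1) ^ (-s.re)) hf
    (((continuousOn_zeta1 hs).mono hsub).aestronglyMeasurable measurableSet_Ioi) ?_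
  filter_upwards [ae_restrict_mem measurableSet_Ioi] with x hx
  exact norm_zeta1_le hs (hsub hx)

theorem tendsto_intervalIntegral_sub_one_atTop {f : ℝ → ℂ}
    (h0 : Filter.Tendsto f Filter.atTop (nhds 0)) :
    Filter.Tendsto (fun T : ℝ => ∫ x in (T - 1)..T, f x) Filter.atTop (nhds 0) := by
  rw [Metric.tendsto_atTop] at h0 ⊢
  intro ε hε
  obtain ⟨N, hN⟩ := h0 (ε / 2) (half_pos hε)
  refine ⟨N + 1, fun T hT => ?_⟩
  have h : ‖∫ x in (T - 1)..T, f x‖ ≤ ε / 2 * |T - (T - 1)| := by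
    refine intervalIntegral.norm_integral_le_of_norm_le_const fun x hx => ?_
    rw [Set.uIoc_of_le (by linarith)] at hx
    simpa using (hN x (by linarith [hx.1])).le
  rw [dist_zero_right]
  have h' : |T - (T - 1)| = 1 := by simp
  rw [h'] at h
  linarith

/-- A telescoping identity: the integral over a unit interval is recovered from backward
differences. -/
theorem intervalIntegral_eq_integral_Ioi_of_backward_difference {f g : ℝ → ℂ}
    (hf : ContinuousOn f (Set.Ici 0)) (h0 : Filter.Tendsto f Filter.atTop (nhds 0))
    (hg : IntegrableOn g (Set.Ioi 1)) (hfg : ∀ x, 1 ≤ x → g x = f (x - 1) - f x) :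
    ∫ x in (0 : ℝ)..1, f x = ∫ x in Set.Ioi 1, g x := by
  have hint : ∀ a b : ℝ, 0 ≤ a → 0 ≤ b → IntervalIntegrable f volume a b := fun a b ha hb =>
    (hf.mono fun x hx => (le_inf ha hb).trans hx.1).intervalIntegrable
  have hlim := intervalIntegral_tendsto_integral_Ioi 1 hg Filter.tendsto_id
  have hlim' : Filter.Tendsto (fun T : ℝ => (∫ x in (0 : ℝ)..1, f x) - ∫ x in (T - 1)..T, f x)
      Filter.atTop (nhds (∫ x in (0 : ℝ)..1, f x)) := by
    simpa using tendsto_const_nhds.sub (tendsto_intervalIntegral_sub_one_atTop h0)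
  refine tendsto_nhds_unique (hlim'.congr' ?_) hlim
  filter_upwards [Filter.eventually_ge_atTop 1] with T hT
  have hcongr : ∫ x in (1 : ℝ)..T, g x = ∫ x in (1 : ℝ)..T, (f (x - 1) - f x) := by
    refine intervalIntegral.integral_congr fun x hx => hfg x ?_
    rw [Set.uIcc_of_le hT] at hx
    exact hx.1
  have hshift : IntervalIntegrable (fun x => f (x - 1)) volume 1 T := by
    have h := (hint 0 (T - 1) le_rfl (by linarith)).comp_sub_right 1
    simpa using h
  rw [id, hcongr, intervalIntegral.integral_sub hshift (hint _ _ (by linarith) (by linarith)),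
    intervalIntegral.integral_comp_sub_right, sub_self,
    ← intervalIntegral.integral_add_adjacent_intervals (hint 0 1 le_rfl zero_le_one)
      (hint 1 (T - 1) zero_le_one (by linarith)),
    ← intervalIntegral.integral_add_adjacent_intervals
      (hint 1 (T - 1) zero_le_one (by linarith)) (hint (T - 1) T (by linarith) (by linarith))]
  ring

theorem stmt_10 (u₁ u₂ u₃ u₄ : ℂ)
    (h₁ : 1 < u₁.re) (h₂ : 1 < u₂.re) (h₃ : 1 < u₃.re) (h₄ : 1 < u₄.re) :
    ∫ α in (0 : ℝ)..1, zeta1 u₁ α * zeta1 u₂ α * zeta1 u₃ α * zeta1 u₄ α =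
      1 / (u₁ + u₂ + u₃ + u₄ - 1)
        -- single-zeta terms: exponent is minus the sum of the other three
        + (∫ α in Set.Ioi (1 : ℝ), (α : ℂ) ^ (-(u₂ + u₃ + u₄)) * zeta1 u₁ α)
        + (∫ α in Set.Ioi (1 : ℝ), (α : ℂ) ^ (-(u₁ + u₃ + u₄)) * zeta1 u₂ α)
        + (∫ α in Set.Ioi (1 : ℝ), (α : ℂ) ^ (-(u₁ + u₂ + u₄)) * zeta1 u₃ α)
        + (∫ α in Set.Ioi (1 : ℝ), (α : ℂ) ^ (-(u₁ + u₂ + u₃)) * zeta1 u₄ α)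
        -- double-zeta terms: one for each pair {i,j}
        + (∫ α in Set.Ioi (1 : ℝ), (α : ℂ) ^ (-(u₁ + u₂)) * zeta1 u₃ α * zeta1 u₄ α)
        + (∫ α in Set.Ioi (1 : ℝ), (α : ℂ) ^ (-(u₁ + u₃)) * zeta1 u₂ α * zeta1 u₄ α)
        + (∫ α in Set.Ioi (1 : ℝ), (α : ℂ) ^ (-(u₁ + u₄)) * zeta1 u₂ α * zeta1 u₃ α)
        + (∫ α in Set.Ioi (1 : ℝ), (α : ℂ) ^ (-(u₂ + u₃)) * zeta1 u₁ α * zeta1 u₄ α)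
        + (∫ α in Set.Ioi (1 : ℝ), (α : ℂ) ^ (-(u₂ + u₄)) * zeta1 u₁ α * zeta1 u₃ α)
        + (∫ α in Set.Ioi (1 : ℝ), (α : ℂ) ^ (-(u₃ + u₄)) * zeta1 u₁ α * zeta1 u₂ α)
        -- triple-zeta terms
        + (∫ α in Set.Ioi (1 : ℝ), (α : ℂ) ^ (-u₁) * (zeta1 u₂ α * zeta1 u₃ α * zeta1 u₄ α))
        + (∫ α in Set.Ioi (1 : ℝ), (α : ℂ) ^ (-u₂) * (zeta1 u₁ α * zeta1 u₃ α * zeta1 u₄ α))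
        + (∫ α in Set.Ioi (1 : ℝ), (α : ℂ) ^ (-u₃) * (zeta1 u₁ α * zeta1 u₂ α * zeta1 u₄ α))
        + ∫ α in Set.Ioi (1 : ℝ), (α : ℂ) ^ (-u₄) * (zeta1 u₁ α * zeta1 u₂ α * zeta1 u₃ α) := by
  have hcpow : ∀ a : ℂ, 1 < a.re → IntegrableOn (fun α : ℝ => (α : ℂ) ^ (-a)) (Set.Ioi 1) :=
    fun a ha => integrableOn_Ioi_cpow_of_lt (by simpa using ha) one_pos
  have I₁₂₃₄ : IntegrableOn (fun α : ℝ => (α : ℂ) ^ (-(u₁ + u₂ + u₃ + u₄)))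
      (Set.Ioi 1) :=
    hcpow (u₁ + u₂ + u₃ + u₄) (by simp only [add_re]; linarith)
  have I₂₃₄ : IntegrableOn (fun α : ℝ => (α : ℂ) ^ (-(u₂ + u₃ + u₄)) * zeta1 u₁ α)
      (Set.Ioi 1) :=
    (hcpow (u₂ + u₃ + u₄) (by simp only [add_re]; linarith)).mul_zeta1 h₁
  have I₁₃₄ : IntegrableOn (fun α : ℝ => (α : ℂ) ^ (-(u₁ + u₃ + u₄)) * zeta1 u₂ α)
      (Set.Ioi 1) :=
    (hcpow (u₁ + u₃ + u₄) (by simp only [add_re]; linarith)).mul_zeta1 h₂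
  have I₁₂₄ : IntegrableOn (fun α : ℝ => (α : ℂ) ^ (-(u₁ + u₂ + u₄)) * zeta1 u₃ α)
      (Set.Ioi 1) :=
    (hcpow (u₁ + u₂ + u₄) (by simp only [add_re]; linarith)).mul_zeta1 h₃
  have I₁₂₃ : IntegrableOn (fun α : ℝ => (α : ℂ) ^ (-(u₁ + u₂ + u₃)) * zeta1 u₄ α)
      (Set.Ioi 1) :=
    (hcpow (u₁ + u₂ + u₃) (by simp only [add_re]; linarith)).mul_zeta1 h₄
  have I₁₂ : IntegrableOn (fun α : ℝ => (α : ℂ) ^ (-(u₁ + u₂)) * zeta1 u₃ α * zeta1 u₄ α)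
      (Set.Ioi 1) :=
    ((hcpow (u₁ + u₂) (by simp only [add_re]; linarith)).mul_zeta1 h₃).mul_zeta1 h₄
  have I₁₃ : IntegrableOn (fun α : ℝ => (α : ℂ) ^ (-(u₁ + u₃)) * zeta1 u₂ α * zeta1 u₄ α)
      (Set.Ioi 1) :=
    ((hcpow (u₁ + u₃) (by simp only [add_re]; linarith)).mul_zeta1 h₂).mul_zeta1 h₄
  have I₁₄ : IntegrableOn (fun α : ℝ => (α : ℂ) ^ (-(u₁ + u₄)) * zeta1 u₂ α * zeta1 u₃ α)
      (Set.Ioi 1) :=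
    ((hcpow (u₁ + u₄) (by simp only [add_re]; linarith)).mul_zeta1 h₂).mul_zeta1 h₃
  have I₂₃ : IntegrableOn (fun α : ℝ => (α : ℂ) ^ (-(u₂ + u₃)) * zeta1 u₁ α * zeta1 u₄ α)
      (Set.Ioi 1) :=
    ((hcpow (u₂ + u₃) (by simp only [add_re]; linarith)).mul_zeta1 h₁).mul_zeta1 h₄
  have I₂₄ : IntegrableOn (fun α : ℝ => (α : ℂ) ^ (-(u₂ + u₄)) * zeta1 u₁ α * zeta1 u₃ α)
      (Set.Ioi 1) :=
    ((hcpow (u₂ + u₄) (by simp only [add_re]; linarith)).mul_zeta1 h₁).mul_zeta1 h₃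
  have I₃₄ : IntegrableOn (fun α : ℝ => (α : ℂ) ^ (-(u₃ + u₄)) * zeta1 u₁ α * zeta1 u₂ α)
      (Set.Ioi 1) :=
    ((hcpow (u₃ + u₄) (by simp only [add_re]; linarith)).mul_zeta1 h₁).mul_zeta1 h₂
  have I₁ : IntegrableOn (fun α : ℝ => (α : ℂ) ^ (-u₁) * (zeta1 u₂ α * zeta1 u₃ α * zeta1 u₄ α))
      (Set.Ioi 1) := by
    simpa only [mul_assoc] using
      (((hcpow u₁ h₁).mul_zeta1 h₂).mul_zeta1 h₃).mul_zeta1 h₄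
  have I₂ : IntegrableOn (fun α : ℝ => (α : ℂ) ^ (-u₂) * (zeta1 u₁ α * zeta1 u₃ α * zeta1 u₄ α))
      (Set.Ioi 1) := by
    simpa only [mul_assoc] using
      (((hcpow u₂ h₂).mul_zeta1 h₁).mul_zeta1 h₃).mul_zeta1 h₄
  have I₃ : IntegrableOn (fun α : ℝ => (α : ℂ) ^ (-u₃) * (zeta1 u₁ α * zeta1 u₂ α * zeta1 u₄ α))
      (Set.Ioi 1) := by
    simpa only [mul_assoc] using
      (((hcpow u₃ h₃).mul_zeta1 h₁).mul_zeta1 h₂).mul_zeta1 h₄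
  have I₄ : IntegrableOn (fun α : ℝ => (α : ℂ) ^ (-u₄) * (zeta1 u₁ α * zeta1 u₂ α * zeta1 u₃ α))
      (Set.Ioi 1) := by
    simpa only [mul_assoc] using
      (((hcpow u₄ h₄).mul_zeta1 h₁).mul_zeta1 h₂).mul_zeta1 h₃
  have h_main : ∫ α in Set.Ioi (1 : ℝ), (α : ℂ) ^ (-(u₁ + u₂ + u₃ + u₄)) =
      1 / (u₁ + u₂ + u₃ + u₄ - 1) := by
    rw [integral_Ioi_cpow_of_lt (by simp only [neg_re, add_re]; linarith) one_pos, ofReal_one,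
      one_cpow, ← neg_div_neg_eq, neg_neg]
    congr 1
    ring
  rw [← h_main]
  have S₁ := Integrable.fun_add I₁₂₃₄ I₂₃₄
  have S₂ := Integrable.fun_add S₁ I₁₃₄
  have S₃ := Integrable.fun_add S₂ I₁₂₄
  have S₄ := Integrable.fun_add S₃ I₁₂₃
  have S₅ := Integrable.fun_add S₄ I₁₂
  have S₆ := Integrable.fun_add S₅ I₁₃
  have S₇ := Integrable.fun_add S₆ I₁₄
  have S₈ := Integrable.fun_add S₇ I₂₃
  have S₉ := Integrable.fun_add S₈ I₂₄
  have S₁₀ := Integrable.fun_add S₉ I₃₄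
  have S₁₁ := Integrable.fun_add S₁₀ I₁
  have S₁₂ := Integrable.fun_add S₁₁ I₂
  have S₁₃ := Integrable.fun_add S₁₂ I₃
  have S₁₄ := Integrable.fun_add S₁₃ I₄
  rw [intervalIntegral_eq_integral_Ioi_of_backward_difference
    (g := fun α : ℝ => (α : ℂ) ^ (-(u₁ + u₂ + u₃ + u₄))
      + (α : ℂ) ^ (-(u₂ + u₃ + u₄)) * zeta1 u₁ α
      + (α : ℂ) ^ (-(u₁ + u₃ + u₄)) * zeta1 u₂ α
      + (α : ℂ) ^ (-(u₁ + u₂ + u₄)) * zeta1 u₃ α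
      + (α : ℂ) ^ (-(u₁ + u₂ + u₃)) * zeta1 u₄ α
      + (α : ℂ) ^ (-(u₁ + u₂)) * zeta1 u₃ α * zeta1 u₄ α
      + (α : ℂ) ^ (-(u₁ + u₃)) * zeta1 u₂ α * zeta1 u₄ α
      + (α : ℂ) ^ (-(u₁ + u₄)) * zeta1 u₂ α * zeta1 u₃ α
      + (α : ℂ) ^ (-(u₂ + u₃)) * zeta1 u₁ α * zeta1 u₄ α
      + (α : ℂ) ^ (-(u₂ + u₄)) * zeta1 u₁ α * zeta1 u₃ α
      + (α : ℂ) ^ (-(u₃ + u₄)) * zeta1 u₁ α * zeta1 u₂ α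
      + (α : ℂ) ^ (-u₁) * (zeta1 u₂ α * zeta1 u₃ α * zeta1 u₄ α)
      + (α : ℂ) ^ (-u₂) * (zeta1 u₁ α * zeta1 u₃ α * zeta1 u₄ α)
      + (α : ℂ) ^ (-u₃) * (zeta1 u₁ α * zeta1 u₂ α * zeta1 u₄ α)
      + (α : ℂ) ^ (-u₄) * (zeta1 u₁ α * zeta1 u₂ α * zeta1 u₃ α)) ?_ ?_ S₁₄ fun α hα => ?_]
  · rw [integral_add S₁₃ I₄, integral_add S₁₂ I₃, integral_add S₁₁ I₂, integral_add S₁₀ I₁,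
      integral_add S₉ I₃₄, integral_add S₈ I₂₄, integral_add S₇ I₂₃, integral_add S₆ I₁₄,
      integral_add S₅ I₁₃, integral_add S₄ I₁₂, integral_add S₃ I₁₂₃, integral_add S₂ I₁₂₄,
      integral_add S₁ I₁₃₄, integral_add I₁₂₃₄ I₂₃₄]
  · exact (((continuousOn_zeta1 h₁).mul (continuousOn_zeta1 h₂)).mul (continuousOn_zeta1 h₃)).mul
      (continuousOn_zeta1 h₄)
  · simpa using (((tendsto_zeta1_atTop h₁).mul (tendsto_zeta1_atTop h₂)).mul
      (tendsto_zeta1_atTop h₃)).mul (tendsto_zeta1_atTop h₄)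
  · have hα0 : (α : ℂ) ≠ 0 := ofReal_ne_zero.2 (by linarith)
    simp only [zeta1_sub_one h₁ hα, zeta1_sub_one h₂ hα, zeta1_sub_one h₃ hα,
      zeta1_sub_one h₄ hα, neg_add, cpow_add _ _ hα0]
    ring
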